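/- Let Q be a convex graph property and let p = p(n) satisfy p(1−p)N → ∞ as n → ∞, where N = n(n−1)/2. Then G(n,p) almost surely satisfies Q if and only if for every fixed x ∈ ℝ, G(n,M) almost surely satisfies Q, where M = ⌊pN + x·(p(1−p)N)^{1/2}⌋. -/

import Mathlib

open Filter Asymptotics
open scoped Classical

noncomputable section

/-- The number of edges of a simple graph on a finite vertex type. -/
def edgeCount {V : Type*} [Fintype V] (G : SimpleGraph V) : ℕ :=
  G.edgeFinset.card

/-- Probability in the Erdős–Rényi model `G(n,p)` of a set `A` of graphs on `Fin n`:
each of the `n.choose 2` possible edges is present independently with probability `p`. -/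
def gnpProb (n : ℕ) (p : ℝ) (A : Set (SimpleGraph (Fin n))) : ℝ :=
  ∑ G ∈ Finset.univ.filter (fun G => G ∈ A),
    p ^ edgeCount G * (1 - p) ^ (n.choose 2 - edgeCount G)

/-- Probability in the uniform model `G(n,M)` of a set `A` of graphs on `Fin n`:
all graphs with exactly `M` edges are equally likely. -/
def gnmProb (n M : ℕ) (A : Set (SimpleGraph (Fin n))) : ℝ :=
  ((Finset.univ.filter (fun G : SimpleGraph (Fin n) => edgeCount G = M ∧ G ∈ A)).card : ℝ) /
    ((Finset.univ.filter (fun G : SimpleGraph (Fin n) => edgeCount G = M)).card : ℝ)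

/-- `κ(S)`: the largest number of internally disjoint trees connecting `S`, i.e. trees
`T₁, …, T_k` of `G` with `S ⊆ V(Tᵢ)`, `V(Tᵢ) ∩ V(Tⱼ) = S` and `E(Tᵢ) ∩ E(Tⱼ) = ∅`
for `i ≠ j`. -/
def kappaSet {V : Type*} (G : SimpleGraph V) (S : Set V) : ℕ :=
  sSup {k | ∃ T : Fin k → G.Subgraph,
    (∀ i, S ⊆ (T i).verts ∧ ((T i).coe).IsTree) ∧
    (∀ i j, i ≠ j → (T i).verts ∩ (T j).verts = S ∧
      (T i).edgeSet ∩ (T j).edgeSet = ∅)}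

/-- `λ(S)`: the largest number of pairwise edge-disjoint trees of `G` each containing `S`. -/
def lambdaSet {V : Type*} (G : SimpleGraph V) (S : Set V) : ℕ :=
  sSup {k | ∃ T : Fin k → G.Subgraph,
    (∀ i, S ⊆ (T i).verts ∧ ((T i).coe).IsTree) ∧
    (∀ i j, i ≠ j → (T i).edgeSet ∩ (T j).edgeSet = ∅)}

/-- The generalized `r`-connectivity `κ_r(G)`: the minimum of `κ(S)` over `r`-subsets `S`,
and `0` if `G` is disconnected. -/
def genKappa {V : Type*} [Fintype V] (r : ℕ) (G : SimpleGraph V) : ℕ :=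
  if G.Connected then
    sInf {k | ∃ S : Finset V, S.card = r ∧ kappaSet G ↑S = k}
  else 0

/-- The generalized `r`-edge-connectivity `λ_r(G)`: the minimum of `λ(S)` over
`r`-subsets `S`, and `0` if `G` is disconnected. -/
def genLambda {V : Type*} [Fintype V] (r : ℕ) (G : SimpleGraph V) : ℕ :=
  if G.Connected then
    sInf {k | ∃ S : Finset V, S.card = r ∧ lambdaSet G ↑S = k}
  else 0

/-- The vertex connectivity `κ(G)`: the largest `k` such that `G` is `k`-connected,
i.e. `k < |V|` and the removal of fewer than `k` vertices leaves a connected graph. -/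
def vertexConnectivity {V : Type*} [Fintype V] (G : SimpleGraph V) : ℕ :=
  sSup {k | k < Fintype.card V ∧
    ∀ S : Finset V, S.card < k → (G.induce ((↑S : Set V)ᶜ)).Connected}

/-- The edge connectivity `λ(G)`: the largest `k` such that removing fewer than `k`
edges always leaves a connected graph. -/
def edgeConnectivity {V : Type*} [Fintype V] (G : SimpleGraph V) : ℕ :=
  sSup {k | ∀ F : Finset (Sym2 V), F.card < k → (G.deleteEdges ↑F).Connected}

/-- The minimum degree `δ(G)`. -/
def minDeg {V : Type*} [Fintype V] (G : SimpleGraph V) : ℕ :=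
  G.minDegree

/-- The number of children of `v` in the graph `H` viewed as rooted at `r`:
neighbours of `v` lying one step further from the root. -/
def childCount {W : Type*} (H : SimpleGraph W) (r v : W) : ℕ :=
  {w | H.Adj v w ∧ H.dist r w = H.dist r v + 1}.ncard

/-- The depth of the graph `H` viewed as rooted at `r`: the largest distance from `r`. -/
def rootedDepth {W : Type*} (H : SimpleGraph W) (r : W) : ℕ :=
  sSup (Set.range (H.dist r))

/-- `T` is a subtree of `G` rooted at `r`, of depth `d`, in which every non-leaf
vertex has exactly `t` children (a `t`-ary tree of depth `d`). -/
def IsAryTreeOfDepth {V : Type*} {G : SimpleGraph V} (T : G.Subgraph) (r : V)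
    (t d : ℕ) : Prop :=
  ∃ hr : r ∈ T.verts,
    T.coe.IsTree ∧ rootedDepth T.coe ⟨r, hr⟩ = d ∧
      ∀ v : T.verts, childCount T.coe ⟨r, hr⟩ v = 0 ∨ childCount T.coe ⟨r, hr⟩ v = t

end

/-- The probability that a binomial variable with parameters `N` and `p` equals `k`. -/
def binomialWeight (N : ℕ) (p : ℝ) (k : ℕ) : ℝ :=
  (N.choose k : ℝ) * p ^ k * (1 - p) ^ (N - k)

theorem binomialWeight_nonneg {p : ℝ} (hp0 : 0 ≤ p) (hp1 : p ≤ 1) (N k : ℕ) :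
    0 ≤ binomialWeight N p k := by
  have : 0 ≤ 1 - p := by linarith
  unfold binomialWeight
  positivity

theorem sum_binomialWeight (N : ℕ) (p : ℝ) :
    ∑ k ∈ Finset.range (N + 1), binomialWeight N p k = 1 := by
  have h := congrArg (Polynomial.eval p) (bernsteinPolynomial.sum ℝ N)
  simpa [Polynomial.eval_finsetSum, bernsteinPolynomial, binomialWeight] using h

theorem sum_sq_mul_binomialWeight (N : ℕ) (p : ℝ) :
    ∑ k ∈ Finset.range (N + 1), ((k : ℝ) - p * N) ^ 2 * binomialWeight N p k =
      p * (1 - p) * N := by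
  have h := congrArg (Polynomial.eval p) (bernsteinPolynomial.variance ℝ N)
  simp [Polynomial.eval_finsetSum, bernsteinPolynomial] at h
  rw [show p * (1 - p) * N = N * p * (1 - p) by ring, ← h]
  refine Finset.sum_congr rfl fun k _ => ?_
  unfold binomialWeight
  ring

theorem binomialWeight_sub {N k : ℕ} (hk : k ≤ N) (p : ℝ) :
    binomialWeight N p (N - k) = binomialWeight N (1 - p) k := by
  unfold binomialWeight
  rw [Nat.choose_symm hk, Nat.sub_sub_self hk]
  ring

theorem binomialWeight_succ_mul {N k : ℕ} (hk : k < N) (p : ℝ) :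
    binomialWeight N p (k + 1) * (((k : ℝ) + 1) * (1 - p)) =
      binomialWeight N p k * (((N : ℝ) - k) * p) := by
  have h : (N.choose (k + 1) : ℝ) * (k + 1) = N.choose k * ((N : ℝ) - k) := by
    have := Nat.choose_succ_right_eq N k
    rw [← Nat.cast_sub hk.le]
    exact_mod_cast this
  have e : N - k = (N - (k + 1)) + 1 := by omega
  unfold binomialWeight
  rw [e, pow_succ, pow_succ]
  linear_combination p ^ k * p * (1 - p) ^ (N - (k + 1)) * (1 - p) * h

/-- Consecutive binomial weights decay slowly at bounded distance (in standard deviations)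
above the mean. -/
theorem mul_binomialWeight_le_succ {N k : ℕ} {p σ T : ℝ} (hp0 : 0 < p) (hp1 : p < 1)
    (hσ : σ ^ 2 = p * (1 - p) * N) (hσ1 : 1 ≤ σ) (hT : 0 ≤ T) (hTσ : 2 * T + 2 < σ)
    (hk : (k : ℝ) ≤ p * N + T * σ) :
    (1 - (2 * T + 2) / σ) * binomialWeight N p k ≤ binomialWeight N p (k + 1) := by
  have hσ0 : 0 < σ := by linarith
  have hq : 0 < 1 - p := by linarith
  have hu : 0 < 1 - (2 * T + 2) / σ := by
    rw [sub_pos, div_lt_one hσ0]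
    exact hTσ
  have hden : 0 < ((k : ℝ) + 1) * (1 - p) := by positivity
  have hden_le : ((k : ℝ) + 1) * (1 - p) ≤ σ ^ 2 + (T + 1) * σ := by
    have h1 := mul_le_mul_of_nonneg_right hk hq.le
    have h2 : T * σ * (1 - p) ≤ T * σ := by nlinarith [mul_nonneg hT hσ0.le]
    nlinarith
  have hnum_ge : σ ^ 2 - T * σ ≤ ((N : ℝ) - k) * p := by
    have h1 := mul_le_mul_of_nonneg_right hk hp0.le
    have h2 : T * σ * p ≤ T * σ := by nlinarith [mul_nonneg hT hσ0.le]
    nlinarith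
  have hratio : (1 - (2 * T + 2) / σ) * (((k : ℝ) + 1) * (1 - p)) ≤ ((N : ℝ) - k) * p := by
    have e : (1 - (2 * T + 2) / σ) * (σ ^ 2 + (T + 1) * σ) =
        σ ^ 2 - (T + 1) * σ - (2 * T + 2) * (T + 1) := by
      field_simp
      ring
    have h1 := mul_le_mul_of_nonneg_left hden_le hu.le
    nlinarith [mul_nonneg hT hT]
  have hkN : k < N := by
    have h1 : 0 < ((N : ℝ) - k) * p := lt_of_lt_of_le (mul_pos hu hden) hratio
    have h2 : 0 < (N : ℝ) - k := pos_of_mul_pos_left h1 hp0.le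
    exact_mod_cast sub_pos.mp h2
  refine le_of_mul_le_mul_right ?_ hden
  rw [binomialWeight_succ_mul hkN]
  have := mul_le_mul_of_nonneg_left hratio (binomialWeight_nonneg hp0.le hp1.le N k)
  linarith

theorem exp_neg_two_mul_le_one_sub {u : ℝ} (h0 : 0 ≤ u) (h1 : u ≤ 1 / 2) :
    Real.exp (-(2 * u)) ≤ 1 - u := by
  have h := Real.add_one_le_exp (2 * u)
  rw [Real.exp_neg, inv_le_comm₀ (Real.exp_pos _) (by linarith)]
  refine le_trans ?_ h
  rw [inv_le_iff_one_le_mul₀ (by linarith)]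
  nlinarith

theorem exp_mul_binomialWeight_le_add {N k s : ℕ} {p σ T : ℝ} (hp0 : 0 < p) (hp1 : p < 1)
    (hσ : σ ^ 2 = p * (1 - p) * N) (hσ1 : 1 ≤ σ) (hT : 0 ≤ T) (hTσ : 2 * (2 * T + 2) ≤ σ)
    (hk : (k : ℝ) + s ≤ p * N + T * σ) :
    Real.exp (-(2 * ((2 * T + 2) / σ) * s)) * binomialWeight N p k ≤
      binomialWeight N p (k + s) := by
  have hσ0 : 0 < σ := by linarith
  have hu : Real.exp (-(2 * ((2 * T + 2) / σ))) ≤ 1 - (2 * T + 2) / σ := by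
    apply exp_neg_two_mul_le_one_sub
    · positivity
    · rw [div_le_iff₀ hσ0]
      linarith
  induction s with
  | zero => simp
  | succ s ih =>
    push_cast at hk ⊢
    have hb := binomialWeight_nonneg hp0.le hp1.le N (k + s)
    calc Real.exp (-(2 * ((2 * T + 2) / σ) * (s + 1))) * binomialWeight N p k
        = Real.exp (-(2 * ((2 * T + 2) / σ))) *
            (Real.exp (-(2 * ((2 * T + 2) / σ) * s)) * binomialWeight N p k) := by
          rw [← mul_assoc, ← Real.exp_add]
          ring_nf
      _ ≤ Real.exp (-(2 * ((2 * T + 2) / σ))) * binomialWeight N p (k + s) := by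
          gcongr
          exact ih (by linarith)
      _ ≤ (1 - (2 * T + 2) / σ) * binomialWeight N p (k + s) := by gcongr
      _ ≤ binomialWeight N p (k + (s + 1)) :=
          mul_binomialWeight_le_succ hp0 hp1 hσ hσ1 hT (by linarith)
            (by push_cast; linarith)

/-- Chebyshev's inequality for the binomial distribution. -/
theorem three_quarters_le_sum_binomialWeight {N : ℕ} {p σ : ℝ} (hp0 : 0 ≤ p) (hp1 : p ≤ 1)
    (hσ : σ ^ 2 = p * (1 - p) * N) (hσ0 : 0 < σ) :
    3 / 4 ≤ ∑ k ∈ Finset.range (N + 1) with |((k : ℕ) : ℝ) - p * N| ≤ 2 * σ,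
      binomialWeight N p k := by
  have h1 := sum_binomialWeight N p
  have h2 := sum_sq_mul_binomialWeight N p
  rw [← Finset.sum_filter_add_sum_filter_not _
    (fun k : ℕ => |((k : ℕ) : ℝ) - p * N| ≤ 2 * σ)] at h1
  have h3 : ∑ k ∈ Finset.range (N + 1) with ¬ |((k : ℕ) : ℝ) - p * N| ≤ 2 * σ,
      (4 * σ ^ 2) * binomialWeight N p k ≤ σ ^ 2 := by
    rw [hσ, ← h2]
    refine le_trans (Finset.sum_le_sum fun k hk => ?_)
      (Finset.sum_le_sum_of_subset_of_nonneg (Finset.filter_subset _ _) fun k _ _ =>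
        mul_nonneg (sq_nonneg _) (binomialWeight_nonneg hp0 hp1 N k))
    rw [h2]
    refine mul_le_mul_of_nonneg_right ?_ (binomialWeight_nonneg hp0 hp1 N k)
    have h4 := (Finset.mem_filter.mp hk).2
    rw [← hσ, ← sq_abs ((k : ℝ) - p * N)]
    nlinarith
  rw [← Finset.mul_sum] at h3
  have h5 : 0 < σ ^ 2 := by positivity
  have h6 : ∑ k ∈ Finset.range (N + 1) with ¬ |((k : ℕ) : ℝ) - p * N| ≤ 2 * σ,
      binomialWeight N p k ≤ 1 / 4 := by
    refine le_of_mul_le_mul_left ?_ h5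
    linarith
  linarith

theorem exists_le_upper_tail (T : ℝ) (hT : 0 ≤ T) :
    ∃ c > 0, ∃ σ₀ > 0, ∀ (N : ℕ) (p σ : ℝ), 0 ≤ p → p ≤ 1 → σ ^ 2 = p * (1 - p) * N →
      σ₀ ≤ σ → c ≤ ∑ k ∈ Finset.range (N + 1) with p * N + T * σ ≤ ((k : ℕ) : ℝ),
        binomialWeight N p k := by
  refine ⟨Real.exp (-(2 * (2 * (T + 5) + 2) * (T + 3))) * (3 / 4), by positivity,
    2 * (2 * (T + 5) + 2), by positivity, fun N p σ hp0 hp1 hσ hσ₀ => ?_⟩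
  set C := Real.exp (-(2 * (2 * (T + 5) + 2) * (T + 3))) with hC
  have hC0 : 0 < C := Real.exp_pos _
  have hσ1 : 1 ≤ σ := by linarith
  have hσ0 : 0 < σ := by linarith
  have hp0' : 0 < p := by
    refine lt_of_le_of_ne hp0 fun h => ?_
    rw [← h] at hσ
    nlinarith
  have hp1' : p < 1 := by
    refine lt_of_le_of_ne hp1 fun h => ?_
    rw [h] at hσ
    nlinarith
  set s := ⌈(T + 2) * σ⌉₊ with hs
  have hs1 : (T + 2) * σ ≤ s := Nat.le_ceil _
  have hs2 : (s : ℝ) < (T + 2) * σ + 1 := Nat.ceil_lt_add_one (by positivity)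
  have hshift : ∀ k : ℕ, |(k : ℝ) - p * N| ≤ 2 * σ →
      C * binomialWeight N p k ≤ binomialWeight N p (k + s) := by
    intro k hk
    refine le_trans ?_ (exp_mul_binomialWeight_le_add (T := T + 5) hp0' hp1' hσ hσ1
      (by linarith) hσ₀ ?_)
    · refine mul_le_mul_of_nonneg_right ?_ (binomialWeight_nonneg hp0 hp1 N k)
      rw [hC]
      refine Real.exp_le_exp.mpr (neg_le_neg ?_)
      have h1 : (s : ℝ) / σ ≤ T + 3 := by
        rw [div_le_iff₀ hσ0]
        linarith
      calc 2 * ((2 * (T + 5) + 2) / σ) * (s : ℝ) = 2 * (2 * (T + 5) + 2) * (s / σ) := by ring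
        _ ≤ 2 * (2 * (T + 5) + 2) * (T + 3) := by gcongr
    · have := (abs_le.mp hk).2
      linarith
  calc C * (3 / 4)
      ≤ C * ∑ k ∈ Finset.range (N + 1) with |((k : ℕ) : ℝ) - p * N| ≤ 2 * σ,
          binomialWeight N p k := by
        gcongr
        exact three_quarters_le_sum_binomialWeight hp0 hp1 hσ hσ0
    _ ≤ ∑ k ∈ Finset.range (N + 1) with |((k : ℕ) : ℝ) - p * N| ≤ 2 * σ,
          binomialWeight N p (k + s) := by
        rw [Finset.mul_sum]
        exact Finset.sum_le_sum fun k hk => hshift k (Finset.mem_filter.mp hk).2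
    _ = ∑ k ∈ (Finset.range (N + 1)).filter (fun k : ℕ => |((k : ℕ) : ℝ) - p * N| ≤ 2 * σ) |>.map
          (addRightEmbedding s), binomialWeight N p k := by
        rw [Finset.sum_map]
        rfl
    _ ≤ _ := by
        refine Finset.sum_le_sum_of_subset_of_nonneg ?_ fun k _ _ =>
          binomialWeight_nonneg hp0 hp1 N k
        intro j hj
        obtain ⟨k, hk, rfl⟩ := Finset.mem_map.mp hj
        obtain ⟨hkN, hk⟩ := Finset.mem_filter.mp hk
        have hpos : 0 < binomialWeight N p k := by
          have : 0 < N.choose k := Nat.choose_pos (by simpa [Nat.lt_succ_iff] using hkN)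
          have : 0 < 1 - p := by linarith
          unfold binomialWeight
          positivity
        have hpos' := (mul_pos hC0 hpos).trans_le (hshift k hk)
        simp only [addRightEmbedding_apply, Finset.mem_filter, Finset.mem_range]
        refine ⟨?_, ?_⟩
        · by_contra hlt
          rw [binomialWeight, Nat.choose_eq_zero_of_lt (by omega)] at hpos'
          simp at hpos'
        · have := (abs_le.mp hk).1
          push_cast
          linarith

theorem exists_le_lower_tail (T : ℝ) (hT : 0 ≤ T) :
    ∃ c > 0, ∃ σ₀ > 0, ∀ (N : ℕ) (p σ : ℝ), 0 ≤ p → p ≤ 1 → σ ^ 2 = p * (1 - p) * N →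
      σ₀ ≤ σ → c ≤ ∑ k ∈ Finset.range (N + 1) with ((k : ℕ) : ℝ) ≤ p * N - T * σ,
        binomialWeight N p k := by
  obtain ⟨c, hc, σ₀, hσ₀, h⟩ := exists_le_upper_tail T hT
  refine ⟨c, hc, σ₀, hσ₀, fun N p σ hp0 hp1 hσ hle => ?_⟩
  refine (h N (1 - p) σ (by linarith) (by linarith) (by rw [hσ]; ring) hle).trans_eq ?_
  refine Finset.sum_bij' (fun k _ => N - k) (fun k _ => N - k) ?_ ?_ ?_ ?_ ?_
  · intro k hk
    simp only [Finset.mem_filter, Finset.mem_range] at hk ⊢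
    refine ⟨by omega, ?_⟩
    rw [Nat.cast_sub (by omega)]
    linarith [hk.2]
  · intro k hk
    simp only [Finset.mem_filter, Finset.mem_range] at hk ⊢
    refine ⟨by omega, ?_⟩
    rw [Nat.cast_sub (by omega)]
    linarith [hk.2]
  · intro k hk
    simp only [Finset.mem_filter, Finset.mem_range] at hk
    omega
  · intro k hk
    simp only [Finset.mem_filter, Finset.mem_range] at hk
    omega
  · intro k hk
    simp only [Finset.mem_filter, Finset.mem_range] at hk
    rw [binomialWeight_sub (by omega)]

theorem exists_mul_le_sum_mul {w g : ℕ → ℝ} {S R : Finset ℕ} {c : ℝ} (hSR : S ⊆ R)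
    (hc : 0 < c) (hw : ∀ k, 0 ≤ w k) (hg : ∀ k, 0 ≤ g k) (hS : c ≤ ∑ k ∈ S, w k) :
    ∃ k ∈ S, c * g k ≤ ∑ j ∈ R, w j * g j := by
  have hne : S.Nonempty := by
    rw [Finset.nonempty_iff_ne_empty]
    rintro rfl
    simp at hS
    linarith
  obtain ⟨k, hk, hmin⟩ := S.exists_min_image g hne
  refine ⟨k, hk, ?_⟩
  calc c * g k ≤ (∑ j ∈ S, w j) * g k := mul_le_mul_of_nonneg_right hS (hg k)
    _ = ∑ j ∈ S, w j * g k := Finset.sum_mul _ _ _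
    _ ≤ ∑ j ∈ S, w j * g j :=
        Finset.sum_le_sum fun j hj => mul_le_mul_of_nonneg_left (hmin j hj) (hw j)
    _ ≤ ∑ j ∈ R, w j * g j :=
        Finset.sum_le_sum_of_subset_of_nonneg hSR fun j _ _ => mul_nonneg (hw j) (hg j)

/-- Transfer between binomial averages and pointwise limits for a sequence of functions `f n`
whose deficits `1 - f n` are controlled by the deficits at any two surrounding points. -/
theorem tendsto_binomial_average_iff (N : ℕ → ℕ) (p : ℕ → ℝ) (hp0 : ∀ n, 0 ≤ p n)
    (hp1 : ∀ n, p n ≤ 1) (hN : Tendsto (fun n => p n * (1 - p n) * (N n : ℝ)) atTop atTop)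
    (f : ℕ → ℕ → ℝ) (hf1 : ∀ n k, f n k ≤ 1)
    (hf0 : ∀ n k, 0 ≤ f n k) (hfN : ∀ n k, N n < k → f n k = 0)
    (hf : ∀ n k₁ k k₂, k₁ ≤ k → k ≤ k₂ → k₂ ≤ N n →
      1 - f n k ≤ (1 - f n k₁) + (1 - f n k₂)) :
    Tendsto (fun n => ∑ k ∈ Finset.range (N n + 1), binomialWeight (N n) (p n) k * f n k)
      atTop (nhds 1) ↔
    ∀ x : ℝ, Tendsto (fun n => f n ⌊p n * (N n : ℝ) +
      x * Real.sqrt (p n * (1 - p n) * (N n : ℝ))⌋₊) atTop (nhds 1) := by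
  have hw := fun n => binomialWeight_nonneg (hp0 n) (hp1 n) (N n)
  have hdef : ∀ n, ∑ k ∈ Finset.range (N n + 1), binomialWeight (N n) (p n) k * (1 - f n k) =
      1 - ∑ k ∈ Finset.range (N n + 1), binomialWeight (N n) (p n) k * f n k := by
    intro n
    simp only [mul_sub, Finset.sum_sub_distrib, mul_one, sum_binomialWeight]
  have hσsq : ∀ n, Real.sqrt (p n * (1 - p n) * (N n : ℝ)) ^ 2 =
      p n * (1 - p n) * (N n : ℝ) := fun n =>
    Real.sq_sqrt (mul_nonneg (mul_nonneg (hp0 n) (sub_nonneg.mpr (hp1 n))) (Nat.cast_nonneg _))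
  have hσ : Tendsto (fun n => Real.sqrt (p n * (1 - p n) * (N n : ℝ))) atTop atTop :=
    Real.tendsto_sqrt_atTop.comp hN
  constructor
  · intro h x
    obtain ⟨c, hc, σ₁, -, hup⟩ := exists_le_upper_tail |x| (abs_nonneg x)
    obtain ⟨d, hd, σ₂, -, hlow⟩ := exists_le_lower_tail |x| (abs_nonneg x)
    have hlim : Tendsto (fun n => 1 - (1 / c + 1 / d) *
        (1 - ∑ k ∈ Finset.range (N n + 1), binomialWeight (N n) (p n) k * f n k))
        atTop (nhds 1) := by
      simpa using ((h.const_sub 1).const_mul (1 / c + 1 / d)).const_sub 1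
    refine tendsto_of_tendsto_of_tendsto_of_le_of_le' hlim tendsto_const_nhds ?_
      (Eventually.of_forall fun n => hf1 n _)
    filter_upwards [hσ.eventually_ge_atTop σ₁, hσ.eventually_ge_atTop σ₂] with n h1 h2
    have hg : ∀ k, 0 ≤ 1 - f n k := fun k => sub_nonneg.mpr (hf1 n k)
    obtain ⟨k₂, hk₂, hb₂⟩ := exists_mul_le_sum_mul (Finset.filter_subset _ _) hc (hw n) hg
      (hup (N n) (p n) _ (hp0 n) (hp1 n) (hσsq n) h1)
    obtain ⟨k₁, hk₁, hb₁⟩ := exists_mul_le_sum_mul (Finset.filter_subset _ _) hd (hw n) hg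
      (hlow (N n) (p n) _ (hp0 n) (hp1 n) (hσsq n) h2)
    rw [hdef] at hb₁ hb₂
    simp only [Finset.mem_filter, Finset.mem_range] at hk₁ hk₂
    set σ := Real.sqrt (p n * (1 - p n) * (N n : ℝ))
    have hσ0 : 0 ≤ σ := Real.sqrt_nonneg _
    have hx1 : -(|x| * σ) ≤ x * σ := by nlinarith [neg_abs_le x]
    have hx2 : x * σ ≤ |x| * σ := by nlinarith [le_abs_self x]
    have key := hf n k₁ ⌊p n * (N n : ℝ) + x * σ⌋₊ k₂
      (Nat.le_floor (by linarith)) (Nat.floor_le_of_le (by linarith)) (by omega)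
    rw [mul_comm, ← le_div_iff₀ (by assumption)] at hb₁ hb₂
    have e : ∀ t : ℝ, (1 / c + 1 / d) * t = t / c + t / d := fun t => by ring
    rw [e]
    linarith
  · intro h
    have hbound : ∀ y : ℝ, 0 < y → ∀ᶠ n in atTop,
        1 - ∑ k ∈ Finset.range (N n + 1), binomialWeight (N n) (p n) k * f n k ≤
        ((1 - f n ⌊p n * (N n : ℝ) + (-y) * Real.sqrt (p n * (1 - p n) * (N n : ℝ))⌋₊) +
        (1 - f n ⌊p n * (N n : ℝ) + y * Real.sqrt (p n * (1 - p n) * (N n : ℝ))⌋₊)) +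
          1 / y ^ 2 := by
      intro y hy
      filter_upwards [hσ.eventually_gt_atTop 0, (h y).eventually_const_lt one_pos] with n h1 h2
      have hsq := hσsq n
      have hvar := sum_sq_mul_binomialWeight (N n) (p n)
      rw [← hsq] at hvar
      rw [← hdef]
      set σ := Real.sqrt (p n * (1 - p n) * (N n : ℝ))
      set A := (1 - f n ⌊p n * (N n : ℝ) + (-y) * σ⌋₊) + (1 - f n ⌊p n * (N n : ℝ) + y * σ⌋₊)
        with hA
      have hA0 : 0 ≤ A := by
        have := hf1 n ⌊p n * (N n : ℝ) + (-y) * σ⌋₊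
        have := hf1 n ⌊p n * (N n : ℝ) + y * σ⌋₊
        linarith
      have hle : ⌊p n * (N n : ℝ) + y * σ⌋₊ ≤ N n := by
        by_contra hlt
        rw [hfN n _ (not_le.mp hlt)] at h2
        exact lt_irrefl _ h2
      have hpt : ∀ k : ℕ, 1 - f n k ≤
          A + ((k : ℝ) - p n * N n) ^ 2 * (1 / (y * σ) ^ 2) := by
        intro k
        by_cases hk : |(k : ℝ) - p n * N n| ≤ y * σ
        · obtain ⟨ha, hb⟩ := abs_le.mp hk
          have := hf n ⌊p n * (N n : ℝ) + (-y) * σ⌋₊ k ⌊p n * (N n : ℝ) + y * σ⌋₊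
            (Nat.floor_le_of_le (by linarith)) (Nat.le_floor (by linarith)) hle
          have : 0 ≤ ((k : ℝ) - p n * N n) ^ 2 * (1 / (y * σ) ^ 2) := by positivity
          linarith
        · have h3 : 1 ≤ ((k : ℝ) - p n * N n) ^ 2 * (1 / (y * σ) ^ 2) := by
            rw [mul_one_div, one_le_div (by positivity), ← sq_abs ((k : ℝ) - p n * N n)]
            exact pow_le_pow_left₀ (by positivity) (not_le.mp hk).le 2
          have := hf0 n k
          linarith
      calc ∑ k ∈ Finset.range (N n + 1), binomialWeight (N n) (p n) k * (1 - f n k)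
          ≤ ∑ k ∈ Finset.range (N n + 1), binomialWeight (N n) (p n) k *
              (A + ((k : ℝ) - p n * N n) ^ 2 * (1 / (y * σ) ^ 2)) :=
            Finset.sum_le_sum fun k _ => mul_le_mul_of_nonneg_left (hpt k) (hw n k)
        _ = A * ∑ k ∈ Finset.range (N n + 1), binomialWeight (N n) (p n) k +
            (1 / (y * σ) ^ 2) * ∑ k ∈ Finset.range (N n + 1),
              ((k : ℝ) - p n * N n) ^ 2 * binomialWeight (N n) (p n) k := by
            rw [Finset.mul_sum, Finset.mul_sum, ← Finset.sum_add_distrib]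
            exact Finset.sum_congr rfl fun k _ => by ring
        _ = A + 1 / y ^ 2 := by
            rw [sum_binomialWeight, hvar, mul_pow]
            field_simp
    rw [tendsto_order]
    refine ⟨fun a ha => ?_, fun a ha => Eventually.of_forall fun n => ?_⟩
    · obtain ⟨y, hy, hya⟩ : ∃ y : ℝ, 0 < y ∧ 1 / y ^ 2 < 1 - a := by
        have hlim : Tendsto (fun y : ℝ => 1 / y ^ 2) atTop (nhds 0) := by
          simpa [Function.comp_def] using
            tendsto_inv_atTop_zero.comp (tendsto_pow_atTop (α := ℝ) two_ne_zero)
        exact ((eventually_gt_atTop 0).and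
          (hlim.eventually_lt_const (sub_pos.mpr ha))).exists
      have hlim : Tendsto (fun n =>
          ((1 - f n ⌊p n * (N n : ℝ) + (-y) * Real.sqrt (p n * (1 - p n) * (N n : ℝ))⌋₊) +
          (1 - f n ⌊p n * (N n : ℝ) + y * Real.sqrt (p n * (1 - p n) * (N n : ℝ))⌋₊)) +
          1 / y ^ 2) atTop (nhds (1 / y ^ 2)) := by
        simpa only [sub_self, zero_add] using
          (((h (-y)).const_sub 1).add ((h y).const_sub 1)).add_const (1 / y ^ 2)
      filter_upwards [hbound y hy, hlim.eventually_lt_const hya] with n h1 h2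
      linarith
    · refine lt_of_le_of_lt ?_ ha
      rw [← sum_binomialWeight (N n) (p n)]
      exact Finset.sum_le_sum fun k _ => mul_le_of_le_one_right (hw n k) (hf1 n k)

/-- The proportion of a lower family among the sets of given size decreases with the size. -/
theorem IsLowerSet.antitone_card_div_choose {α : Type*} [Fintype α] {𝒟 : Set (Finset α)}
    (h𝒟 : IsLowerSet 𝒟) :
    Antitone fun k : ℕ => (((Finset.univ : Finset (Finset α)).filter
      (fun s => s.card = k ∧ s ∈ 𝒟)).card : ℝ) / (Fintype.card α).choose k := by
  refine antitone_nat_of_succ_le fun k => ?_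
  refine (Finset.local_lubell_yamamoto_meshalkin_inequality_div (𝕜 := ℝ)
    (Nat.succ_ne_zero k) (fun s hs => ?_)).trans ?_
  · exact (Finset.mem_filter.mp (Finset.mem_coe.mp hs)).2.1
  · rw [Nat.succ_sub_one]
    gcongr
    intro t ht
    obtain ⟨s, hs, hts, hcard⟩ := Finset.mem_shadow_iff_exists_mem_card_add_one.mp ht
    obtain ⟨-, hs1, hs2⟩ := Finset.mem_filter.mp hs
    exact Finset.mem_filter.mpr ⟨Finset.mem_univ _, by omega, h𝒟 hts hs2⟩

/-- The graphs on `V`, ordered by inclusion, are the finite sets of potential edges. -/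
noncomputable def edgeFinsetOrderIso (V : Type*) [Fintype V] :
    Finset {e : Sym2 V // ¬ e.IsDiag} ≃o SimpleGraph V where
  toFun s := SimpleGraph.fromEdgeSet {e | ∃ h : ¬ e.IsDiag, ⟨e, h⟩ ∈ s}
  invFun G := Finset.univ.filter fun e => e.1 ∈ G.edgeSet
  left_inv s := by
    ext ⟨e, he⟩
    simp [he]
  right_inv G := by
    rw [← SimpleGraph.edgeSet_inj]
    ext e
    have := fun h : e ∈ G.edgeSet => G.not_isDiag_of_mem_edgeSet h
    simp
    tauto
  map_rel_iff' := by
    intro s t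
    rw [← SimpleGraph.edgeSet_subset_edgeSet]
    simp only [Equiv.coe_fn_mk, SimpleGraph.edgeSet_fromEdgeSet]
    constructor
    · rintro h ⟨e, he⟩ hs
      obtain ⟨⟨_, h1⟩, -⟩ := h (a := e) ⟨⟨he, hs⟩, he⟩
      exact h1
    · rintro h e ⟨⟨he, hs⟩, h2⟩
      exact ⟨⟨he, h hs⟩, h2⟩

theorem edgeCount_edgeFinsetOrderIso {V : Type*} [Fintype V]
    (s : Finset {e : Sym2 V // ¬ e.IsDiag}) :
    edgeCount (edgeFinsetOrderIso V s) = s.card := by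
  rw [edgeCount, ← Finset.card_map (Function.Embedding.subtype _)]
  congr 1
  ext e
  rw [SimpleGraph.mem_edgeFinset]
  simp [edgeFinsetOrderIso]

theorem card_potential_edges (n : ℕ) :
    Fintype.card {e : Sym2 (Fin n) // ¬ e.IsDiag} = n.choose 2 := by
  rw [Sym2.card_subtype_not_diag, Fintype.card_fin]

theorem card_filter_edgeCount_and (n k : ℕ) (A : Set (SimpleGraph (Fin n))) :
    (Finset.univ.filter fun G : SimpleGraph (Fin n) => edgeCount G = k ∧ G ∈ A).card =
      (Finset.univ.filter fun s : Finset {e : Sym2 (Fin n) // ¬ e.IsDiag} =>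
        s.card = k ∧ s ∈ edgeFinsetOrderIso (Fin n) ⁻¹' A).card := by
  symm
  refine Finset.card_equiv (edgeFinsetOrderIso (Fin n)).toEquiv fun s => ?_
  simp [edgeCount_edgeFinsetOrderIso]

theorem card_filter_edgeCount (n k : ℕ) :
    (Finset.univ.filter fun G : SimpleGraph (Fin n) => edgeCount G = k).card =
      (n.choose 2).choose k := by
  have h := card_filter_edgeCount_and n k Set.univ
  simp only [Set.mem_univ, and_true, Set.preimage_univ] at h
  rw [h, ← card_potential_edges, ← Finset.card_univ, ← Finset.card_powersetCard]
  congr 1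
  ext s
  simp [Finset.mem_powersetCard]

theorem gnmProb_eq (n k : ℕ) (A : Set (SimpleGraph (Fin n))) :
    gnmProb n k A =
      ((Finset.univ.filter fun G : SimpleGraph (Fin n) => edgeCount G = k ∧ G ∈ A).card : ℝ) /
        (n.choose 2).choose k := by
  rw [gnmProb, card_filter_edgeCount]

theorem gnmProb_nonneg (n k : ℕ) (A : Set (SimpleGraph (Fin n))) : 0 ≤ gnmProb n k A := by
  unfold gnmProb
  positivity

theorem gnmProb_mono (n k : ℕ) {A B : Set (SimpleGraph (Fin n))} (h : A ⊆ B) :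
    gnmProb n k A ≤ gnmProb n k B := by
  unfold gnmProb
  gcongr

theorem gnmProb_add_compl {n k : ℕ} (hk : k ≤ n.choose 2) (A : Set (SimpleGraph (Fin n))) :
    gnmProb n k A + gnmProb n k Aᶜ = 1 := by
  have hpos : (((n.choose 2).choose k : ℕ) : ℝ) ≠ 0 := by
    exact_mod_cast (Nat.choose_pos hk).ne'
  rw [gnmProb_eq, gnmProb_eq, ← add_div, div_eq_one_iff_eq hpos, ← card_filter_edgeCount,
    ← Finset.card_filter_add_card_filter_not (s := Finset.univ.filter
      fun G : SimpleGraph (Fin n) => edgeCount G = k) (fun G => G ∈ A),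
    Finset.filter_filter, Finset.filter_filter]
  simp only [Set.mem_compl_iff, Nat.cast_add]

theorem gnmProb_eq_zero_of_lt {n k : ℕ} (hk : n.choose 2 < k)
    (A : Set (SimpleGraph (Fin n))) : gnmProb n k A = 0 := by
  rw [gnmProb_eq, Nat.choose_eq_zero_of_lt hk]
  simp

theorem gnmProb_le_one (n k : ℕ) (A : Set (SimpleGraph (Fin n))) : gnmProb n k A ≤ 1 := by
  rcases le_or_gt k (n.choose 2) with hk | hk
  · linarith [gnmProb_add_compl hk A, gnmProb_nonneg n k Aᶜ]
  · rw [gnmProb_eq_zero_of_lt hk]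
    exact zero_le_one

theorem gnmProb_union_le (n k : ℕ) (A B : Set (SimpleGraph (Fin n))) :
    gnmProb n k (A ∪ B) ≤ gnmProb n k A + gnmProb n k B := by
  rw [gnmProb, gnmProb, gnmProb, ← add_div]
  gcongr
  rw [← Nat.cast_add, Nat.cast_le]
  refine le_trans (Finset.card_le_card fun G hG => ?_) (Finset.card_union_le _ _)
  simp only [Finset.mem_filter, Finset.mem_union, Set.mem_union] at hG ⊢
  tauto

theorem gnmProb_antitone {n : ℕ} {D : Set (SimpleGraph (Fin n))} (hD : IsLowerSet D) :
    Antitone fun k => gnmProb n k D := by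
  have h : IsLowerSet (edgeFinsetOrderIso (Fin n) ⁻¹' D) :=
    fun s t hts hs => hD ((edgeFinsetOrderIso (Fin n)).monotone hts) hs
  have := h.antitone_card_div_choose
  rw [card_potential_edges] at this
  simpa only [gnmProb_eq, card_filter_edgeCount_and] using this

theorem one_sub_gnmProb {n k : ℕ} (hk : k ≤ n.choose 2) (A : Set (SimpleGraph (Fin n))) :
    1 - gnmProb n k A = gnmProb n k Aᶜ := by
  linarith [gnmProb_add_compl hk A]

/-- The failure probability of a convex property at `k` edges is at most the sum of the failure
probabilities at two surrounding numbers of edges. -/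
theorem one_sub_gnmProb_le_of_ordConnected {n k₁ k k₂ : ℕ} {A : Set (SimpleGraph (Fin n))}
    (hA : A.OrdConnected) (h₁ : k₁ ≤ k) (h₂ : k ≤ k₂) (hk₂ : k₂ ≤ n.choose 2) :
    1 - gnmProb n k A ≤ (1 - gnmProb n k₁ A) + (1 - gnmProb n k₂ A) := by
  have hU := (upperClosure A).upper
  have hL := (lowerClosure A).lower
  rw [one_sub_gnmProb (h₂.trans hk₂), one_sub_gnmProb ((h₁.trans h₂).trans hk₂)]
  calc gnmProb n k Aᶜ
      ≤ gnmProb n k ((upperClosure A : Set (SimpleGraph (Fin n)))ᶜ) +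
          gnmProb n k ((lowerClosure A : Set (SimpleGraph (Fin n)))ᶜ) := by
        conv_lhs => rw [← hA.upperClosure_inter_lowerClosure, Set.compl_inter]
        exact gnmProb_union_le _ _ _ _
    _ ≤ gnmProb n k₁ ((upperClosure A : Set (SimpleGraph (Fin n)))ᶜ) +
          (1 - gnmProb n k₂ (lowerClosure A : Set (SimpleGraph (Fin n)))) := by
        rw [← one_sub_gnmProb (h₂.trans hk₂) (lowerClosure A : Set (SimpleGraph (Fin n)))]
        exact add_le_add (gnmProb_antitone hU.compl h₁)
          (sub_le_sub_left (gnmProb_antitone hL h₂) 1)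
    _ ≤ gnmProb n k₁ Aᶜ + (1 - gnmProb n k₂ A) :=
        add_le_add (gnmProb_mono _ _ (Set.compl_subset_compl.mpr subset_upperClosure))
          (sub_le_sub_left (gnmProb_mono _ _ subset_lowerClosure) 1)

theorem edgeCount_le (n : ℕ) (G : SimpleGraph (Fin n)) : edgeCount G ≤ n.choose 2 := by
  rw [← (edgeFinsetOrderIso (Fin n)).apply_symm_apply G, edgeCount_edgeFinsetOrderIso,
    ← card_potential_edges]
  exact Finset.card_le_univ _

theorem gnpProb_eq_sum (n : ℕ) (p : ℝ) (A : Set (SimpleGraph (Fin n))) :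
    gnpProb n p A = ∑ k ∈ Finset.range (n.choose 2 + 1),
      binomialWeight (n.choose 2) p k * gnmProb n k A := by
  rw [gnpProb, ← Finset.sum_fiberwise_of_maps_to (t := Finset.range (n.choose 2 + 1))
    (g := edgeCount) fun G _ => Finset.mem_range.mpr (Nat.lt_succ_of_le (edgeCount_le n G))]
  refine Finset.sum_congr rfl fun k hk => ?_
  have hpos : (((n.choose 2).choose k : ℕ) : ℝ) ≠ 0 := by
    exact_mod_cast (Nat.choose_pos (Nat.lt_succ_iff.mp (Finset.mem_range.mp hk))).ne'
  rw [Finset.sum_congr rfl (g := fun _ => p ^ k * (1 - p) ^ (n.choose 2 - k))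
    fun G hG => by rw [(Finset.mem_filter.mp hG).2], Finset.sum_const, nsmul_eq_mul,
    Finset.filter_filter, gnmProb_eq, binomialWeight]
  simp only [and_comm]
  field_simp

/-- For a convex, isomorphism-closed graph property `Q` and `p` with `p(1−p)N → ∞`
(`N = n(n−1)/2`), `G(n,p)` almost surely satisfies `Q` iff for every fixed `x ∈ ℝ`,
`G(n,M)` almost surely satisfies `Q`, where `M = ⌊pN + x (p(1−p)N)^{1/2}⌋`. -/
theorem gnp_iff_gnm_for_convex (Q : (n : ℕ) → Set (SimpleGraph (Fin n)))
    (hiso : ∀ (n : ℕ) (G G' : SimpleGraph (Fin n)),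
      Nonempty (G ≃g G') → (G ∈ Q n ↔ G' ∈ Q n))
    (hconv : ∀ (n : ℕ) (F G H : SimpleGraph (Fin n)),
      F ≤ G → G ≤ H → F ∈ Q n → H ∈ Q n → G ∈ Q n)
    (p : ℕ → ℝ) (hp0 : ∀ n, 0 ≤ p n) (hp1 : ∀ n, p n ≤ 1)
    (hN : Tendsto (fun n : ℕ => p n * (1 - p n) * (n.choose 2 : ℝ)) atTop atTop) :
    Tendsto (fun n : ℕ => gnpProb n (p n) (Q n)) atTop (nhds 1) ↔
      ∀ x : ℝ, Tendsto (fun n : ℕ =>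
        gnmProb n ⌊p n * (n.choose 2 : ℝ) +
          x * Real.sqrt (p n * (1 - p n) * (n.choose 2 : ℝ))⌋₊ (Q n))
        atTop (nhds 1) := by
  have hord : ∀ n, (Q n).OrdConnected := fun n =>
    ⟨fun F hF H hH G hG => hconv n F G H hG.1 hG.2 hF hH⟩
  simp only [gnpProb_eq_sum]
  exact tendsto_binomial_average_iff (fun n => n.choose 2) p hp0 hp1 hN
    (fun n k => gnmProb n k (Q n)) (fun n k => gnmProb_le_one n k _)
    (fun n k => gnmProb_nonneg n k _) (fun n k hk => gnmProb_eq_zero_of_lt hk _)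
    (fun n k₁ k k₂ h₁ h₂ hk₂ => one_sub_gnmProb_le_of_ordConnected (hord n) h₁ h₂ hk₂)
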